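/- Let ε ≥ 0 and let W_0, …, W_k be a greedy-ε run of length k whose final committee covers at least k voters, i.e., cov(W_k) ≥ k (as holds, for instance, for the exact greedy algorithm whenever at least k voters have nonempty approval sets). Then (1 + ε(1 − 1/e)) · cov(W_k) ≥ (1 − 1/e) · opt(k); that is, the greedy-ε algorithm is ((1 − 1/e) · 1/(1 + ε(1 − 1/e)))-approximate for the approval-based Chamberlin–Courant problem. -/

import Mathlib

open Finset

/-- The coverage of a committee `W`: the number of voters `i` whose approval set
`A i` intersects `W`. -/
def cov {V C : Type*} [Fintype V] [DecidableEq C] (A : V → Finset C) (W : Finset C) : ℕ :=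
  (Finset.univ.filter fun i => (A i ∩ W).Nonempty).card

theorem cov_mono {V C : Type*} [Fintype V] [DecidableEq C] (A : V → Finset C) :
    Monotone (cov A) := fun _ _ h =>
  Finset.card_le_card <| Finset.monotone_filter_right _ fun _ _ hi =>
    hi.mono (Finset.inter_subset_inter_left h)

/-- Submodularity of coverage: the coverage of `O` exceeds that of `W` by at most the total
marginal gain over `W` of the members of `O`. -/
theorem cov_le_add_sum_marginal {V C : Type*} [Fintype V] [DecidableEq C] (A : V → Finset C)
    (W O : Finset C) :
    (cov A O : ℝ) ≤ cov A W + ∑ x ∈ O, ((cov A (insert x W) : ℝ) - cov A W) := by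
  classical
  let F : Finset C → Finset V := fun S => Finset.univ.filter fun i => (A i ∩ S).Nonempty
  have hsub : F O ⊆ F W ∪ O.biUnion fun x => F (insert x W) \ F W := by
    intro i hi
    obtain ⟨x, hx⟩ := (Finset.mem_filter.1 hi).2
    obtain ⟨hxA, hxO⟩ := Finset.mem_inter.1 hx
    by_cases hW : i ∈ F W
    · exact Finset.mem_union_left _ hW
    · refine Finset.mem_union_right _ (Finset.mem_biUnion.2 ⟨x, hxO, Finset.mem_sdiff.2 ⟨?_, hW⟩⟩)
      exact Finset.mem_filter.2 ⟨Finset.mem_univ _, x,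
        Finset.mem_inter.2 ⟨hxA, Finset.mem_insert_self _ _⟩⟩
  have hcard : (F O).card ≤ (F W).card + ∑ x ∈ O, (F (insert x W) \ F W).card :=
    (Finset.card_le_card hsub).trans <| (Finset.card_union_le _ _).trans <|
      Nat.add_le_add_left Finset.card_biUnion_le _
  have hgain (x : C) : ((F (insert x W) \ F W).card : ℝ) = (cov A (insert x W) : ℝ) - cov A W :=
    Finset.cast_card_sdiff <| Finset.monotone_filter_right _ fun _ _ hi =>
      hi.mono (Finset.inter_subset_inter_left (Finset.subset_insert _ _))
  have hcast : ((F O).card : ℝ) ≤ (F W).card + ∑ x ∈ O, ((F (insert x W) \ F W).card : ℝ) := by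
    exact_mod_cast hcard
  simp only [hgain] at hcast
  exact hcast

/-- `(1 - 1/k)^k ≤ 1/e`. -/
theorem one_sub_inv_pow_le_inv_exp_one {k : ℕ} (hk : 1 ≤ k) :
    (1 - (k : ℝ)⁻¹) ^ k ≤ (Real.exp 1)⁻¹ := by
  rw [← Real.exp_neg, ← one_div]
  exact Real.one_sub_div_pow_le_exp_neg (by exact_mod_cast hk)

/-- If a greedy-ε run covers at least `k` voters, then
`(1 + ε (1 - 1/e)) · cov (W k) ≥ (1 - 1/e) · opt k`; that is, the greedy-ε
algorithm is `(1 - 1/e) / (1 + ε (1 - 1/e))`-approximate for the approval-based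
Chamberlin–Courant problem. -/
theorem greedy_eps_ratio
    {V C : Type*} [Fintype V] [Fintype C] [DecidableEq C]
    (A : V → Finset C) (ε : ℝ) (hε : 0 ≤ ε)
    (k : ℕ) (hk : 1 ≤ k) (hkm : k ≤ Fintype.card C)
    (W : ℕ → Finset C) (c : ℕ → C)
    (hW0 : W 0 = ∅)
    (hstep : ∀ j < k, W (j + 1) = insert (c (j + 1)) (W j))
    (hnew : ∀ j < k, c (j + 1) ∉ W j)
    (hmax : ∀ j < k, ∀ c' : C, c' ∉ W j →
      (cov A (insert (c (j + 1)) (W j)) : ℝ) - cov A (W j) ≥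
        ((cov A (insert c' (W j)) : ℝ) - cov A (W j)) - ε)
    (hcovk : k ≤ cov A (W k))
    (O : Finset C) (hO : O.card = k) :
    (1 + ε * (1 - (Real.exp 1)⁻¹)) * cov A (W k) ≥
      (1 - (Real.exp 1)⁻¹) * cov A O := by
  have hk0 : (0 : ℝ) < k := by exact_mod_cast hk
  have hr0 : (0 : ℝ) ≤ 1 - (k : ℝ)⁻¹ := sub_nonneg.2 (inv_le_one_of_one_le₀ (by exact_mod_cast hk))
  have hrec : ∀ j < k, (cov A O : ℝ) - cov A (W j) ≤
      k * ((cov A (W (j + 1)) : ℝ) - cov A (W j) + ε) := by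
    intro j hj
    have hgain : ∀ x ∈ O, (cov A (insert x (W j)) : ℝ) - cov A (W j) ≤
        (cov A (W (j + 1)) : ℝ) - cov A (W j) + ε := by
      intro x _
      rw [hstep j hj]
      by_cases hx : x ∈ W j
      · have : (cov A (W j) : ℝ) ≤ cov A (insert (c (j + 1)) (W j)) := by
          exact_mod_cast cov_mono A (Finset.subset_insert _ _)
        rw [Finset.insert_eq_of_mem hx]
        linarith
      · linarith [hmax j hj x hx]
    have hsum := Finset.sum_le_card_nsmul O _ _ hgain
    rw [hO, nsmul_eq_mul] at hsum
    linarith [cov_le_add_sum_marginal A (W j) O]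
  have hgap : ∀ j ≤ k, (cov A O : ℝ) - cov A (W j) - k * ε ≤
      (1 - (k : ℝ)⁻¹) ^ j * (cov A O - k * ε) := by
    intro j
    induction j with
    | zero => intro _; simp
    | succ j ih =>
      intro hj
      have hdiv : ((cov A O : ℝ) - cov A (W j)) * (k : ℝ)⁻¹ ≤
          (cov A (W (j + 1)) : ℝ) - cov A (W j) + ε := by
        rw [← div_eq_mul_inv, div_le_iff₀ hk0, mul_comm]
        exact hrec j hj
      have hcancel : (k : ℝ)⁻¹ * (k * ε) = ε := inv_mul_cancel_left₀ hk0.ne' ε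
      have hmul := mul_le_mul_of_nonneg_left (ih (by omega)) hr0
      rw [pow_succ']
      linarith
  have hfinal := hgap k le_rfl
  have hq := one_sub_inv_pow_le_inv_exp_one hk
  have he : (Real.exp 1)⁻¹ ≤ 1 := inv_le_one_of_one_le₀ (Real.one_le_exp zero_le_one)
  have hcov : (k : ℝ) ≤ cov A (W k) := by exact_mod_cast hcovk
  have hpay := mul_le_mul_of_nonneg_left hcov (mul_nonneg hε (sub_nonneg.2 he))
  rcases le_total ((k : ℝ) * ε) (cov A O) with hopt | hopt
  · have := mul_le_mul_of_nonneg_right hq (sub_nonneg.2 hopt)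
    linarith
  · have := mul_le_mul_of_nonneg_left hopt (sub_nonneg.2 he)
    linarith
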